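/- Every 2-local derivation Δ of the ternary Malcev algebra M_8 is ℂ-linear, and hence is a local derivation of M_8. -/

import Mathlib

noncomputable section

/-- The complex octonions, realized by the Cayley–Dickson construction as
pairs of complex quaternions. -/
abbrev Oct : Type := Quaternion ℂ × Quaternion ℂ

namespace Oct

/-- Octonion multiplication: `(p,q)(r,s) = (pr − s̄q, sp + qr̄)`. -/
def mul (x y : Oct) : Oct :=
  (x.1 * y.1 - star y.2 * x.2, y.2 * x.1 + x.2 * star y.1)

/-- Octonion conjugation: `(p,q) ↦ (p̄, −q)`. -/
def conj (x : Oct) : Oct := (star x.1, -x.2)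

/-- The octonion unit `1 = (1,0)`. -/
def one : Oct := (1, 0)

/-- The symmetric bilinear form `⟨·,·⟩` on the octonions, defined by
`x ȳ + y x̄ = 2 ⟨x,y⟩ · 1` (the left-hand side always lies in `ℂ·1`). -/
def form (x y : Oct) : ℂ := ((mul x (conj y) + mul y (conj x)).1).re / 2

/-- The ternary Malcev product on `M₈`:
`[x,y,z] = (x ȳ) z − ⟨y,z⟩ x + ⟨x,z⟩ y − ⟨x,y⟩ z`. -/
def tmul (x y z : Oct) : Oct :=
  mul (mul x (conj y)) z - form y z • x + form x z • y - form x y • z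

/-- A derivation of the ternary Malcev algebra `M₈`. -/
def IsDer (D : Oct →ₗ[ℂ] Oct) : Prop :=
  ∀ x y z : Oct, D (tmul x y z) = tmul (D x) y z + tmul x (D y) z + tmul x y (D z)

/-- A local derivation of the ternary Malcev algebra `M₈`. -/
def IsLocDer (T : Oct →ₗ[ℂ] Oct) : Prop :=
  ∀ x : Oct, ∃ D : Oct →ₗ[ℂ] Oct, IsDer D ∧ T x = D x

end Oct

namespace Oct

/-- The quaternion with the given coordinates. -/
def quat (a b c d : ℂ) : Quaternion ℂ := ⟨a, b, c, d⟩

@[simp]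
theorem re_quat (a b c d : ℂ) : (quat a b c d).re = a := rfl

@[simp]
theorem imI_quat (a b c d : ℂ) : (quat a b c d).imI = b := rfl

@[simp]
theorem imJ_quat (a b c d : ℂ) : (quat a b c d).imJ = c := rfl

@[simp]
theorem imK_quat (a b c d : ℂ) : (quat a b c d).imK = d := rfl

/-- The octonion with the given eight coordinates. -/
def mk (a b c d a' b' c' d' : ℂ) : Oct := (quat a b c d, quat a' b' c' d')

theorem exists_eq_mk (x : Oct) :
    ∃ a b c d a' b' c' d', x = mk a b c d a' b' c' d' :=
  ⟨_, _, _, _, _, _, _, _, rfl⟩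

theorem mk_congr {a b c d a' b' c' d' p q r s p' q' r' s' : ℂ}
    (h : a = p ∧ b = q ∧ c = r ∧ d = s ∧ a' = p' ∧ b' = q' ∧ c' = r' ∧ d' = s') :
    mk a b c d a' b' c' d' = mk p q r s p' q' r' s' := by
  obtain ⟨rfl, rfl, rfl, rfl, rfl, rfl, rfl, rfl⟩ := h
  rfl

section Coordinates

variable (a b c d a' b' c' d' p q r s p' q' r' s' t : ℂ)

theorem mk_add_mk : mk a b c d a' b' c' d' + mk p q r s p' q' r' s' =
    mk (a + p) (b + q) (c + r) (d + s) (a' + p') (b' + q') (c' + r') (d' + s') := rfl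

theorem mk_sub_mk : mk a b c d a' b' c' d' - mk p q r s p' q' r' s' =
    mk (a - p) (b - q) (c - r) (d - s) (a' - p') (b' - q') (c' - r') (d' - s') := rfl

theorem smul_mk : t • mk a b c d a' b' c' d' =
    mk (t * a) (t * b) (t * c) (t * d) (t * a') (t * b') (t * c') (t * d') := rfl

theorem neg_mk : -mk a b c d a' b' c' d' =
    mk (-a) (-b) (-c) (-d) (-a') (-b') (-c') (-d') := rfl

theorem conj_mk : conj (mk a b c d a' b' c' d') =
    mk a (-b) (-c) (-d) (-a') (-b') (-c') (-d') := by
  ext <;> simp [conj, mk]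

theorem mul_mk_mk : mul (mk a b c d a' b' c' d') (mk p q r s p' q' r' s') =
    mk (a * p - b * q - c * r - d * s - a' * p' - b' * q' - c' * r' - d' * s')
      (a * q + b * p + c * s - d * r - (p' * b' - q' * a' - r' * d' + s' * c'))
      (a * r - b * s + c * p + d * q - (p' * c' + q' * d' - r' * a' - s' * b'))
      (a * s + b * r - c * q + d * p - (p' * d' - q' * c' + r' * b' - s' * a'))
      (p' * a - q' * b - r' * c - s' * d + (a' * p + b' * q + c' * r + d' * s))
      (p' * b + q' * a + r' * d - s' * c + (-a' * q + b' * p - c' * s + d' * r))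
      (p' * c - q' * d + r' * a + s' * b + (-a' * r + b' * s + c' * p - d' * q))
      (p' * d + q' * c - r' * b + s' * a + (-a' * s - b' * r + c' * q + d' * p)) := by
  ext <;> simp [mul, mk] <;> ring

theorem form_mk_mk : form (mk a b c d a' b' c' d') (mk p q r s p' q' r' s') =
    a * p + b * q + c * r + d * s + a' * p' + b' * q' + c' * r' + d' * s' := by
  rw [form, conj_mk, conj_mk, mul_mk_mk, mul_mk_mk, mk_add_mk]
  simp only [mk, re_quat]
  ring

end Coordinates

theorem form_comm (x y : Oct) : form x y = form y x := by
  simp only [form, add_comm]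

theorem form_add_left (x y z : Oct) : form (x + y) z = form x z + form y z := by
  obtain ⟨_, _, _, _, _, _, _, _, rfl⟩ := exists_eq_mk x
  obtain ⟨_, _, _, _, _, _, _, _, rfl⟩ := exists_eq_mk y
  obtain ⟨_, _, _, _, _, _, _, _, rfl⟩ := exists_eq_mk z
  simp only [mk_add_mk, form_mk_mk]
  ring

theorem form_smul_left (t : ℂ) (x y : Oct) : form (t • x) y = t * form x y := by
  obtain ⟨_, _, _, _, _, _, _, _, rfl⟩ := exists_eq_mk x
  obtain ⟨_, _, _, _, _, _, _, _, rfl⟩ := exists_eq_mk y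
  simp only [smul_mk, form_mk_mk]
  ring

/-- The octonion form as a bilinear map. -/
def bilinForm : Oct →ₗ[ℂ] Oct →ₗ[ℂ] ℂ :=
  LinearMap.mk₂ ℂ form form_add_left form_smul_left
    (fun x y z ↦ by simp only [form_comm x, form_add_left])
    (fun t x y ↦ by simp only [form_comm x, form_smul_left, smul_eq_mul])

@[simp]
theorem bilinForm_apply (x y : Oct) : bilinForm x y = form x y := rfl

/-- The standard orthonormal basis of the octonions. -/
def e : Fin 8 → Oct :=
  ![mk 1 0 0 0 0 0 0 0, mk 0 1 0 0 0 0 0 0, mk 0 0 1 0 0 0 0 0, mk 0 0 0 1 0 0 0 0,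
    mk 0 0 0 0 1 0 0 0, mk 0 0 0 0 0 1 0 0, mk 0 0 0 0 0 0 1 0, mk 0 0 0 0 0 0 0 1]

theorem form_e_self (i : Fin 8) : form (e i) (e i) = 1 := by
  fin_cases i <;> simp [e, form_mk_mk]

theorem form_eq_zero_of_forall {x : Oct} (h : ∀ y, form x y = 0) : x = 0 := by
  obtain ⟨_, _, _, _, _, _, _, _, rfl⟩ := exists_eq_mk x
  have h' (i : Fin 8) := h (e i)
  simp only [e, Fin.forall_fin_succ] at h'
  simp [form_mk_mk] at h'
  exact mk_congr h'

theorem form_tmul_self (x y z : Oct) : form (tmul x y z) z = 0 := by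
  obtain ⟨_, _, _, _, _, _, _, _, rfl⟩ := exists_eq_mk x
  obtain ⟨_, _, _, _, _, _, _, _, rfl⟩ := exists_eq_mk y
  obtain ⟨_, _, _, _, _, _, _, _, rfl⟩ := exists_eq_mk z
  simp only [tmul, conj_mk, mul_mk_mk, smul_mk, mk_add_mk, mk_sub_mk, form_mk_mk]
  ring

theorem tmul_add_right (x y z w : Oct) : tmul x y (z + w) = tmul x y z + tmul x y w := by
  obtain ⟨_, _, _, _, _, _, _, _, rfl⟩ := exists_eq_mk x
  obtain ⟨_, _, _, _, _, _, _, _, rfl⟩ := exists_eq_mk y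
  obtain ⟨_, _, _, _, _, _, _, _, rfl⟩ := exists_eq_mk z
  obtain ⟨_, _, _, _, _, _, _, _, rfl⟩ := exists_eq_mk w
  simp only [tmul, conj_mk, mul_mk_mk, smul_mk, mk_add_mk, mk_sub_mk, form_mk_mk]
  refine mk_congr ⟨?_, ?_, ?_, ?_, ?_, ?_, ?_, ?_⟩ <;> ring

theorem form_tmul_right_skew (x y z w : Oct) : form (tmul x y z) w = -form (tmul x y w) z := by
  have h := form_tmul_self x y (z + w)
  rw [tmul_add_right] at h
  simp only [← bilinForm_apply, map_add, LinearMap.add_apply] at h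
  simp only [bilinForm_apply, form_tmul_self] at h
  linear_combination h

theorem sum_tmul_tmul (a b : Oct) :
    ∑ i, tmul (e i) (tmul (e i) b a) a = (6 : ℂ) • (form a b • a - form a a • b) := by
  obtain ⟨_, _, _, _, _, _, _, _, rfl⟩ := exists_eq_mk a
  obtain ⟨_, _, _, _, _, _, _, _, rfl⟩ := exists_eq_mk b
  simp [Fin.sum_univ_eight, e, tmul, conj_mk, mul_mk_mk, smul_mk, mk_add_mk, mk_sub_mk,
    form_mk_mk]
  refine mk_congr ⟨?_, ?_, ?_, ?_, ?_, ?_, ?_, ?_⟩ <;> ring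

/-- The defect of skew-symmetry of `D` with respect to the octonion form. -/
def defect (D : Oct →ₗ[ℂ] Oct) : Oct →ₗ[ℂ] Oct →ₗ[ℂ] ℂ :=
  bilinForm.compl₂ D + bilinForm ∘ₗ D

theorem defect_apply (D : Oct →ₗ[ℂ] Oct) (x y : Oct) :
    defect D x y = form x (D y) + form (D x) y := rfl

theorem defect_comm (D : Oct →ₗ[ℂ] Oct) (x y : Oct) : defect D x y = defect D y x := by
  rw [defect_apply, defect_apply, form_comm x, form_comm (D x), add_comm]

variable {D : Oct →ₗ[ℂ] Oct}

theorem IsDer.defect_tmul_self (hD : IsDer D) (x y z : Oct) : defect D (tmul x y z) z = 0 := by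
  have h : form (D (tmul x y z)) z = form (tmul x y (D z)) z := by
    rw [hD]
    simp only [← bilinForm_apply, map_add, LinearMap.add_apply]
    simp [form_tmul_self]
  rw [defect_apply, h, form_tmul_right_skew x y (D z)]
  ring

theorem IsDer.form_mul_defect (hD : IsDer D) (a b : Oct) :
    form a a * defect D b a = form a b * defect D a a := by
  have h := congrArg (fun v ↦ defect D v a) (sum_tmul_tmul a b)
  simp only [map_sum, LinearMap.sum_apply, hD.defect_tmul_self, map_smul, map_sub,
    LinearMap.smul_apply, LinearMap.sub_apply, smul_eq_mul, Finset.sum_const_zero] at h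
  linear_combination h / 6

theorem IsDer.defect_eq_mul_form (hD : IsDer D) (x y : Oct) :
    defect D x y = defect D one one * form x y := by
  have h1 : form one one = 1 := form_e_self 0
  have hc (b : Oct) : defect D b one = form one b * defect D one one := by
    simpa [h1] using hD.form_mul_defect one b
  have hp := hD.form_mul_defect (one + y) x
  have hm := hD.form_mul_defect (one - y) x
  have hx := hc x
  have hy := hc y
  have hy' := defect_comm D one y
  have hf := form_comm y one
  have hf' := form_comm x y
  simp only [← bilinForm_apply, map_add, map_sub, LinearMap.add_apply, LinearMap.sub_apply]
    at hp hm h1 hx hy hf hf' ⊢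
  have h0 := hD.form_mul_defect y x
  simp only [← bilinForm_apply] at h0
  rw [hy', hy, hx, hf, h1] at hp hm
  rw [hf']
  linear_combination (hp - hm) / 2 - h0

theorem IsDer.defect_one_one (hD : IsDer D) : defect D one one = 0 := by
  have key (i : Fin 8) : form (D (e i)) (e i) = defect D one one / 2 := by
    have h := hD.defect_eq_mul_form (e i) (e i)
    rw [defect_apply, form_comm (e i), form_e_self] at h
    linear_combination h / 2
  have h0 := key 0
  have h1 := key 1
  have h2 := key 2
  have h3 := key 3
  have hw : tmul (e 0) (e 1) (e 2) = -e 3 := by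
    simp [e, tmul, conj_mk, mul_mk_mk, smul_mk, mk_sub_mk, mk_add_mk, neg_mk, form_mk_mk]
  have h := congrArg (fun v ↦ form v (e 3)) (hD (e 0) (e 1) (e 2))
  rw [hw, map_neg] at h
  obtain ⟨_, _, _, _, _, _, _, _, hd0⟩ := exists_eq_mk (D (e 0))
  obtain ⟨_, _, _, _, _, _, _, _, hd1⟩ := exists_eq_mk (D (e 1))
  obtain ⟨_, _, _, _, _, _, _, _, hd2⟩ := exists_eq_mk (D (e 2))
  obtain ⟨_, _, _, _, _, _, _, _, hd3⟩ := exists_eq_mk (D (e 3))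
  rw [hd0, hd1, hd2, hd3] at h
  rw [hd0] at h0
  rw [hd1] at h1
  rw [hd2] at h2
  rw [hd3] at h3
  simp [e, tmul, conj_mk, mul_mk_mk, smul_mk, mk_sub_mk, mk_add_mk, neg_mk, form_mk_mk]
    at h h0 h1 h2 h3
  linear_combination h3 - h0 - h1 - h2 + h

theorem IsDer.form_skew (hD : IsDer D) (x y : Oct) : form (D x) y = -form x (D y) := by
  have h := hD.defect_eq_mul_form x y
  rw [hD.defect_one_one, defect_apply] at h
  linear_combination h

/-- A map that is skew-adjoint for the octonion form is linear. -/
def linearMapOfSkew (f : Oct → Oct) (hf : ∀ x y, form (f x) y = -form x (f y)) :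
    Oct →ₗ[ℂ] Oct where
  toFun := f
  map_add' x y := by
    refine sub_eq_zero.mp (form_eq_zero_of_forall fun z ↦ ?_)
    simp only [← bilinForm_apply] at hf ⊢
    simp only [map_sub, map_add, LinearMap.sub_apply, LinearMap.add_apply, hf]
    ring
  map_smul' c x := by
    refine sub_eq_zero.mp (form_eq_zero_of_forall fun z ↦ ?_)
    simp only [← bilinForm_apply] at hf ⊢
    simp only [map_sub, map_smul, LinearMap.sub_apply, LinearMap.smul_apply, hf, smul_eq_mul,
      RingHom.id_apply]
    ring

end Oct

open Oct in
/-- Every 2-local derivation of the ternary Malcev algebra `M₈` is `ℂ`-linear,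
and hence is a local derivation of `M₈`. -/
theorem two_local_derivation_is_local_derivation_M8
    (Δ : Oct → Oct)
    (h2loc : ∀ x y : Oct, ∃ D : Oct →ₗ[ℂ] Oct, IsDer D ∧ Δ x = D x ∧ Δ y = D y) :
    ∃ T : Oct →ₗ[ℂ] Oct, (∀ x, Δ x = T x) ∧ IsLocDer T := by
  have hskew (x y : Oct) : form (Δ x) y = -form x (Δ y) := by
    obtain ⟨D, hD, hx, hy⟩ := h2loc x y
    rw [hx, hy, hD.form_skew]
  refine ⟨linearMapOfSkew Δ hskew, fun _ ↦ rfl, fun x ↦ ?_⟩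
  obtain ⟨D, hD, hx, -⟩ := h2loc x x
  exact ⟨D, hD, hx⟩
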